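/- For any 3-form φ on a 6-dimensional real vector space V, the endomorphism-valued 6-form square of J_φ(v) = (v ⌟ φ) ∧ φ satisfies J_φ² = (1/6)·id_V ⊗ tr(J_φ²); i.e., J_φ² is a scalar multiple of the identity, with values in S²(Λ⁶(V*)). -/

import Mathlib

open ExteriorAlgebra

/-- The dual functional `⟨v, ·⟩` on `ℝ⁶` associated to a vector `v`. -/
noncomputable def dualV (v : Fin 6 → ℝ) : Module.Dual ℝ (Fin 6 → ℝ) :=
  ∑ i, v i • (LinearMap.proj i : (Fin 6 → ℝ) →ₗ[ℝ] ℝ)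

/-- Interior product (contraction) `v ⌟ φ` of a vector `v ∈ ℝ⁶` with an element of
the exterior algebra `Λ(V*)`, where `V*` is identified with `ℝ⁶`. -/
noncomputable def icontr (v : Fin 6 → ℝ) (φ : ExteriorAlgebra ℝ (Fin 6 → ℝ)) :
    ExteriorAlgebra ℝ (Fin 6 → ℝ) :=
  CliffordAlgebra.contractLeft (dualV v) φ

/-- The basis 1-forms `e¹,…,e⁶` (0-indexed) in the exterior algebra. -/
noncomputable def ee (i : Fin 6) : ExteriorAlgebra ℝ (Fin 6 → ℝ) :=
  ExteriorAlgebra.ι ℝ (Pi.single i 1)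

/-- The volume form `Ω = e¹∧e²∧e³∧e⁴∧e⁵∧e⁶`. -/
noncomputable def vol : ExteriorAlgebra ℝ (Fin 6 → ℝ) :=
  ee 0 * ee 1 * ee 2 * ee 3 * ee 4 * ee 5

/-- The space of 3-forms: the span of the image of `ιMulti ℝ 3`. -/
noncomputable def threeForms : Submodule ℝ (ExteriorAlgebra ℝ (Fin 6 → ℝ)) :=
  Submodule.span ℝ (Set.range (ExteriorAlgebra.ιMulti ℝ 3 (M := Fin 6 → ℝ)))

theorem ee_mul_self (i : Fin 6) : ee i * ee i = 0 :=
  ExteriorAlgebra.ι_sq_zero _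

theorem ee_mul_self_mul (i : Fin 6) (x : ExteriorAlgebra ℝ (Fin 6 → ℝ)) :
    ee i * (ee i * x) = 0 := by
  rw [← mul_assoc, ee_mul_self, zero_mul]

theorem ee_mul_swap {i j : Fin 6} (_h : j < i) : ee i * ee j = -(ee j * ee i) :=
  eq_neg_of_add_eq_zero_left (ExteriorAlgebra.ι_add_mul_swap _ _)

theorem ee_mul_swap_mul {i j : Fin 6} (h : j < i) (x : ExteriorAlgebra ℝ (Fin 6 → ℝ)) :
    ee i * (ee j * x) = -(ee j * (ee i * x)) := by
  rw [← mul_assoc, ee_mul_swap h, neg_mul, mul_assoc]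

theorem ι_eq_sum_ee (a : Fin 6 → ℝ) : ExteriorAlgebra.ι ℝ a = ∑ i, a i • ee i := by
  conv_lhs => rw [pi_eq_sum_univ' a]
  simp [ee, map_sum]

theorem dualV_single (v : Fin 6 → ℝ) (i : Fin 6) : dualV v (Pi.single i 1) = v i := by
  simp [dualV, Pi.single_apply]

theorem icontr_ee_mul (v : Fin 6 → ℝ) (i : Fin 6) (x : ExteriorAlgebra ℝ (Fin 6 → ℝ)) :
    icontr v (ee i * x) = v i • x - ee i * icontr v x := by
  rw [icontr, ee, ExteriorAlgebra.ι, CliffordAlgebra.contractLeft_ι_mul, dualV_single]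
  rfl

theorem icontr_ee (v : Fin 6 → ℝ) (i : Fin 6) :
    icontr v (ee i) = algebraMap ℝ _ (v i) := by
  rw [icontr, ee, ExteriorAlgebra.ι, CliffordAlgebra.contractLeft_ι, dualV_single]

theorem icontr_add (v : Fin 6 → ℝ) (x y : ExteriorAlgebra ℝ (Fin 6 → ℝ)) :
    icontr v (x + y) = icontr v x + icontr v y :=
  map_add _ _ _

theorem icontr_smul (v : Fin 6 → ℝ) (r : ℝ) (x : ExteriorAlgebra ℝ (Fin 6 → ℝ)) :
    icontr v (r • x) = r • icontr v x :=
  map_smul _ _ _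

/-- The 2-form `∑_{i<j} w i j • eⁱ∧eʲ`. -/
noncomputable def twoForm (w : Fin 6 → Fin 6 → ℝ) : ExteriorAlgebra ℝ (Fin 6 → ℝ) :=
  ∑ i, ∑ j, if i < j then w i j • (ee i * ee j) else 0

/-- The 3-form `∑_{i<j<k} c i j k • eⁱ∧eʲ∧eᵏ`. -/
noncomputable def threeForm (c : Fin 6 → Fin 6 → Fin 6 → ℝ) : ExteriorAlgebra ℝ (Fin 6 → ℝ) :=
  ∑ i, ∑ j, ∑ k, if i < j ∧ j < k then c i j k • (ee i * (ee j * ee k)) else 0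

/-- A coefficient tensor that is skew in its first two and in its last two indices. -/
structure IsSkew (c : Fin 6 → Fin 6 → Fin 6 → ℝ) : Prop where
  swap_left : ∀ i j k, c i j k = -c j i k
  swap_right : ∀ i j k, c i j k = -c i k j

theorem exists_eq_sum_of_mem_threeForms {φ : ExteriorAlgebra ℝ (Fin 6 → ℝ)}
    (hφ : φ ∈ threeForms) : ∃ d : Fin 6 → Fin 6 → Fin 6 → ℝ,
      φ = ∑ i, ∑ j, ∑ k, d i j k • (ee i * (ee j * ee k)) := by
  induction hφ using Submodule.span_induction with
  | mem x hx =>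
    obtain ⟨a, rfl⟩ := hx
    refine ⟨fun i j k => a 0 i * (a 1 j * a 2 k), ?_⟩
    have h : ExteriorAlgebra.ιMulti ℝ 3 a =
        ExteriorAlgebra.ι ℝ (a 0) * (ExteriorAlgebra.ι ℝ (a 1) * ExteriorAlgebra.ι ℝ (a 2)) := by
      simp [ExteriorAlgebra.ιMulti_apply]
      rfl
    rw [h, ι_eq_sum_ee, ι_eq_sum_ee, ι_eq_sum_ee, Finset.sum_mul_sum, Finset.sum_mul_sum]
    simp only [Finset.mul_sum, smul_mul_smul_comm]
  | zero => exact ⟨0, by simp⟩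
  | add x y _ _ hx hy =>
    obtain ⟨d, rfl⟩ := hx
    obtain ⟨d', rfl⟩ := hy
    exact ⟨d + d', by simp [add_smul, Finset.sum_add_distrib]⟩
  | smul r x _ hx =>
    obtain ⟨d, rfl⟩ := hx
    exact ⟨r • d, by simp [Finset.smul_sum, mul_smul]⟩

set_option maxHeartbeats 2000000 in
theorem exists_isSkew_threeForm {φ : ExteriorAlgebra ℝ (Fin 6 → ℝ)} (hφ : φ ∈ threeForms) :
    ∃ c, IsSkew c ∧ φ = threeForm c := by
  obtain ⟨d, rfl⟩ := exists_eq_sum_of_mem_threeForms hφ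
  refine ⟨fun i j k => d i j k + d j k i + d k i j - d j i k - d i k j - d k j i,
    ⟨fun i j k => by ring, fun i j k => by ring⟩, ?_⟩
  simp [threeForm, Fin.sum_univ_six, ee_mul_self, ee_mul_self_mul, ee_mul_swap, ee_mul_swap_mul]
  module

theorem icontr_threeForm {c : Fin 6 → Fin 6 → Fin 6 → ℝ} (hc : IsSkew c) (v : Fin 6 → ℝ) :
    icontr v (threeForm c) = twoForm fun i j => ∑ k, v k * c k i j := by
  have h₁ : ∀ {i j k}, j < i → c i j k = -c j i k := fun _ => hc.swap_left _ _ _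
  have h₂ : ∀ {i j k}, k < j → c i j k = -c i k j := fun _ => hc.swap_right _ _ _
  have h₃ : ∀ i k, c i i k = 0 := fun i k => by linarith [hc.swap_left i i k]
  have h₄ : ∀ i k, c i k k = 0 := fun i k => by linarith [hc.swap_right i k k]
  simp [threeForm, twoForm, Fin.sum_univ_six, icontr_add, icontr_smul, icontr_ee_mul, icontr_ee,
    h₁, h₂, h₃, h₄, mul_sub, Algebra.algebraMap_eq_smul_one]
  module

/-- The coefficient of `e^{s 0}∧⋯∧e^{s 4}` in `w ∧ c`, for increasing `s`. -/
def shuffle (w : Fin 6 → Fin 6 → ℝ) (c : Fin 6 → Fin 6 → Fin 6 → ℝ) (s : Fin 5 → Fin 6) : ℝ :=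
  w (s 0) (s 1) * c (s 2) (s 3) (s 4) - w (s 0) (s 2) * c (s 1) (s 3) (s 4)
    + w (s 0) (s 3) * c (s 1) (s 2) (s 4) - w (s 0) (s 4) * c (s 1) (s 2) (s 3)
    + w (s 1) (s 2) * c (s 0) (s 3) (s 4) - w (s 1) (s 3) * c (s 0) (s 2) (s 4)
    + w (s 1) (s 4) * c (s 0) (s 2) (s 3) + w (s 2) (s 3) * c (s 0) (s 1) (s 4)
    - w (s 2) (s 4) * c (s 0) (s 1) (s 3) + w (s 3) (s 4) * c (s 0) (s 1) (s 2)

/-- The vector `u` with `w ∧ c = u ⌟ Ω`. -/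
def wedgeVec (w : Fin 6 → Fin 6 → ℝ) (c : Fin 6 → Fin 6 → Fin 6 → ℝ) : Fin 6 → ℝ :=
  ![shuffle w c ![1, 2, 3, 4, 5], -shuffle w c ![0, 2, 3, 4, 5], shuffle w c ![0, 1, 3, 4, 5],
    -shuffle w c ![0, 1, 2, 4, 5], shuffle w c ![0, 1, 2, 3, 5], -shuffle w c ![0, 1, 2, 3, 4]]

theorem icontr_vol (u : Fin 6 → ℝ) : icontr u vol =
    u 0 • (ee 1 * (ee 2 * (ee 3 * (ee 4 * ee 5)))) - u 1 • (ee 0 * (ee 2 * (ee 3 * (ee 4 * ee 5))))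
    + u 2 • (ee 0 * (ee 1 * (ee 3 * (ee 4 * ee 5)))) - u 3 • (ee 0 * (ee 1 * (ee 2 * (ee 4 * ee 5))))
    + u 4 • (ee 0 * (ee 1 * (ee 2 * (ee 3 * ee 5))))
    - u 5 • (ee 0 * (ee 1 * (ee 2 * (ee 3 * ee 4)))) := by
  simp [vol, mul_assoc, icontr_ee_mul, icontr_ee, mul_sub, Algebra.algebraMap_eq_smul_one]
  module

set_option maxHeartbeats 2000000 in
theorem twoForm_mul_threeForm (w : Fin 6 → Fin 6 → ℝ) (c : Fin 6 → Fin 6 → Fin 6 → ℝ) :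
    twoForm w * threeForm c = icontr (wedgeVec w c) vol := by
  simp [threeForm, twoForm, Fin.sum_univ_six, add_mul, mul_add, mul_assoc, icontr_vol, wedgeVec,
    shuffle, ee_mul_self, ee_mul_self_mul, ee_mul_swap, ee_mul_swap_mul]
  module

/-- The matrix of the endomorphism part of `J_φ` for the 3-form `φ` with coefficients `c`. -/
def jMatrix (c : Fin 6 → Fin 6 → Fin 6 → ℝ) : Matrix (Fin 6) (Fin 6) ℝ :=
  Matrix.of fun l k => wedgeVec (c k) c l

theorem jMatrix_mulVec (c : Fin 6 → Fin 6 → Fin 6 → ℝ) (v : Fin 6 → ℝ) :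
    (jMatrix c).mulVec v = wedgeVec (fun i j => ∑ k, v k * c k i j) c := by
  ext l
  fin_cases l <;>
  · simp [jMatrix, Matrix.mulVec, dotProduct, wedgeVec, shuffle, Fin.sum_univ_six]
    ring

set_option maxHeartbeats 4000000 in
theorem jMatrix_mul_self {c : Fin 6 → Fin 6 → Fin 6 → ℝ} (hc : IsSkew c) :
    jMatrix c * jMatrix c = (jMatrix c * jMatrix c) 0 0 • (1 : Matrix (Fin 6) (Fin 6) ℝ) := by
  have h₁ : ∀ {i j k}, j < i → c i j k = -c j i k := fun _ => hc.swap_left _ _ _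
  have h₂ : ∀ {i j k}, k < j → c i j k = -c i k j := fun _ => hc.swap_right _ _ _
  have h₃ : ∀ i k, c i i k = 0 := fun i k => by linarith [hc.swap_left i i k]
  have h₄ : ∀ i k, c i k k = 0 := fun i k => by linarith [hc.swap_right i k k]
  ext l k
  fin_cases l <;> fin_cases k <;>
    simp [Matrix.mul_apply, Fin.sum_univ_six, jMatrix, wedgeVec, shuffle, h₁, h₂, h₃, h₄] <;>
    ring

/-- for every 3-form `φ` on `ℝ⁶`, the endomorphism part `A` of
`J_φ(v) = (v⌟φ)∧φ` (so that `J_φ(v) = A(v) ⌟ Ω`) satisfies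
`A² = (1/6)·tr(A²)·id`, i.e. `J_φ² = (1/6)·id_V ⊗ tr(J_φ²)`. -/
theorem stmt17 (φ : ExteriorAlgebra ℝ (Fin 6 → ℝ)) (hφ : φ ∈ threeForms) :
    ∃ A : (Fin 6 → ℝ) →ₗ[ℝ] (Fin 6 → ℝ),
      (∀ v, icontr v φ * φ = icontr (A v) vol) ∧
      A ∘ₗ A = ((6 : ℝ)⁻¹ * LinearMap.trace ℝ (Fin 6 → ℝ) (A ∘ₗ A)) • LinearMap.id := by
  obtain ⟨c, hc, rfl⟩ := exists_isSkew_threeForm hφ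
  refine ⟨Matrix.toLin' (jMatrix c), fun v => ?_, ?_⟩
  · rw [icontr_threeForm hc, twoForm_mul_threeForm, Matrix.toLin'_apply, jMatrix_mulVec]
  · rw [← Matrix.toLin'_mul, jMatrix_mul_self hc, Matrix.trace_toLin'_eq, Matrix.trace_smul,
      Matrix.trace_one, map_smul, Matrix.toLin'_one]
    congr 1
    simp
    ring
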